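/- Let c_F ∈ ℂ be nonzero and let λ⁺, λ⁻ ∈ ℂ satisfy λ⁺λ⁻ = q²/((1−q²)(q−q⁻¹)). Then the subalgebra of U_q(sl_3) generated by the three elements E_{αβ} K_{α+β}⁻¹ + λ⁺(1−q⁻²) E_β K_{α+β}⁻¹ + c_F F_{βα} + c_F(q⁻¹−q) λ⁻ F_β K_α⁻¹, E_α K_α⁻¹ + λ⁺ K_α⁻¹, and F_α + λ⁻ K_α⁻¹ is a right coideal subalgebra of U_q(sl_3). -/

import Mathlib

open TensorProduct

/-- `C` is a right coideal subalgebra w.r.t. the comultiplication `Δ`: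
`Δ(C) ⊆ C ⊗ A`, where `C ⊗ A` is the subspace of `A ⊗ A` spanned by `b ⊗ u`, `b ∈ C`. -/
def IsRCS {A : Type*} [Ring A] [Algebra ℂ A] (Δ : A →ₐ[ℂ] A ⊗[ℂ] A)
    (C : Subalgebra ℂ A) : Prop :=
  ∀ x ∈ C, Δ x ∈ Submodule.span ℂ
    {z : A ⊗[ℂ] A | ∃ b ∈ (C : Set A), ∃ u : A, z = b ⊗ₜ[ℂ] u}

/-- An algebra generated by elements whose comultiplication lies in `C ⊗ A` is a right coideal
subalgebra. -/
theorem isRCS_adjoin {A : Type*} [Ring A] [Algebra ℂ A] (Δ : A →ₐ[ℂ] A ⊗[ℂ] A) (s : Set A)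
    (h : ∀ x ∈ s, Δ x ∈ (Algebra.TensorProduct.map (Algebra.adjoin ℂ s).val
      (AlgHom.id ℂ A)).range) :
    IsRCS Δ (Algebra.adjoin ℂ s) := by
  intro x hx
  have hle : Algebra.adjoin ℂ s ≤ (Algebra.TensorProduct.map (Algebra.adjoin ℂ s).val
      (AlgHom.id ℂ A)).range.comap Δ := Algebra.adjoin_le h
  obtain ⟨t, ht⟩ := hle hx
  change _ = Δ x at ht
  rw [← ht]
  clear ht
  induction t with
  | zero => simp
  | add a b ha hb => simpa only [map_add] using Submodule.add_mem _ ha hb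
  | tmul b u => exact Submodule.subset_span ⟨b, b.2, u, rfl⟩

theorem tmul_mem_range_map_val {A : Type*} [Ring A] [Algebra ℂ A] {C : Subalgebra ℂ A} {b : A}
    (hb : b ∈ C) (u : A) :
    b ⊗ₜ[ℂ] u ∈ (Algebra.TensorProduct.map C.val (AlgHom.id ℂ A)).range :=
  ⟨(⟨b, hb⟩ : C) ⊗ₜ[ℂ] u, rfl⟩

theorem mul_eq_smul_mul_of_conj {A : Type*} [Ring A] [Algebra ℂ A] {K K' x : A} {r : ℂ}
    (hK : K' * K = 1) (h : K * x * K' = r • x) : K * x = r • (x * K) := by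
  rw [← smul_mul_assoc, ← h, mul_assoc, hK, mul_one]

theorem inv_mul_eq_smul_mul_of_conj {A : Type*} [Ring A] [Algebra ℂ A] {K K' x : A} {r : ℂ}
    (hr : r ≠ 0) (hK : K' * K = 1) (h : K * x * K' = r • x) : K' * x = r⁻¹ • (x * K') := by
  have : r • (K' * x) = x * K' := by
    rw [← mul_smul_comm, ← h, ← mul_assoc, ← mul_assoc, hK, one_mul]
  rw [← this, inv_smul_smul₀ hr]

/-- Let c_F ≠ 0 and λ⁺λ⁻ = q²/((1-q²)(q-q⁻¹)).  Then the subalgebra of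
U_q(sl₃) generated by
E_{αβ}K_{α+β}⁻¹ + λ⁺(1-q⁻²)E_β K_{α+β}⁻¹ + c_F F_{βα} + c_F(q⁻¹-q)λ⁻ F_β K_α⁻¹,
E_α K_α⁻¹ + λ⁺ K_α⁻¹ and F_α + λ⁻ K_α⁻¹ is a right coideal subalgebra, where
E_{αβ} = E_α E_β - q⁻¹ E_β E_α and F_{βα} = F_α F_β - q F_β F_α. -/
theorem stmt_19 {A : Type*} [Ring A] [Algebra ℂ A] (q : ℂ) (hq : q ≠ 0)
    (hroot : ∀ n : ℕ, n ≠ 0 → q ^ n ≠ 1)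
    (Ea Eb Fa Fb Ka Ka' Kb Kb' : A)
    (hKaKa2 : Ka * Ka' = 1) (hKa2Ka : Ka' * Ka = 1)
    (hKbKb2 : Kb * Kb' = 1) (hKb2Kb : Kb' * Kb = 1)
    (hKK : Ka * Kb = Kb * Ka)
    (hKaEa : Ka * Ea * Ka' = q ^ 2 • Ea)
    (hKaFa : Ka * Fa * Ka' = (q ^ 2)⁻¹ • Fa)
    (hKbEb : Kb * Eb * Kb' = q ^ 2 • Eb)
    (hKbFb : Kb * Fb * Kb' = (q ^ 2)⁻¹ • Fb)
    (hKaEb : Ka * Eb * Ka' = q⁻¹ • Eb)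
    (hKaFb : Ka * Fb * Ka' = q • Fb)
    (hKbEa : Kb * Ea * Kb' = q⁻¹ • Ea)
    (hKbFa : Kb * Fa * Kb' = q • Fa)
    (hEaFa : Ea * Fa - Fa * Ea = (q - q⁻¹)⁻¹ • (Ka - Ka'))
    (hEbFb : Eb * Fb - Fb * Eb = (q - q⁻¹)⁻¹ • (Kb - Kb'))
    (hEaFb : Ea * Fb - Fb * Ea = 0)
    (hEbFa : Eb * Fa - Fa * Eb = 0)
    (hSerreEa : Ea ^ 2 * Eb - (q + q⁻¹) • (Ea * Eb * Ea) + Eb * Ea ^ 2 = 0)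
    (hSerreEb : Eb ^ 2 * Ea - (q + q⁻¹) • (Eb * Ea * Eb) + Ea * Eb ^ 2 = 0)
    (hSerreFa : Fa ^ 2 * Fb - (q + q⁻¹) • (Fa * Fb * Fa) + Fb * Fa ^ 2 = 0)
    (hSerreFb : Fb ^ 2 * Fa - (q + q⁻¹) • (Fb * Fa * Fb) + Fa * Fb ^ 2 = 0)
    (Δ : A →ₐ[ℂ] A ⊗[ℂ] A)
    (hΔEa : Δ Ea = Ea ⊗ₜ[ℂ] 1 + Ka ⊗ₜ[ℂ] Ea)
    (hΔEb : Δ Eb = Eb ⊗ₜ[ℂ] 1 + Kb ⊗ₜ[ℂ] Eb)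
    (hΔFa : Δ Fa = Fa ⊗ₜ[ℂ] Ka' + 1 ⊗ₜ[ℂ] Fa)
    (hΔFb : Δ Fb = Fb ⊗ₜ[ℂ] Kb' + 1 ⊗ₜ[ℂ] Fb)
    (hΔKa : Δ Ka = Ka ⊗ₜ[ℂ] Ka) (hΔKa2 : Δ Ka' = Ka' ⊗ₜ[ℂ] Ka')
    (hΔKb : Δ Kb = Kb ⊗ₜ[ℂ] Kb) (hΔKb2 : Δ Kb' = Kb' ⊗ₜ[ℂ] Kb')
    (cF lamP lamM : ℂ) (hcF : cF ≠ 0)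
    (hll : lamP * lamM = q ^ 2 / ((1 - q ^ 2) * (q - q⁻¹))) :
    IsRCS Δ (Algebra.adjoin ℂ
      {(Ea * Eb - q⁻¹ • (Eb * Ea)) * (Ka' * Kb')
          + (lamP * (1 - (q ^ 2)⁻¹)) • (Eb * (Ka' * Kb'))
          + cF • (Fa * Fb - q • (Fb * Fa))
          + (cF * (q⁻¹ - q) * lamM) • (Fb * Ka'),
        Ea * Ka' + lamP • Ka',
        Fa + lamM • Ka'}) := by
  have hKK' : Kb' * Ka' = Ka' * Kb' :=
    left_inv_eq_right_inv (a := Ka * Kb)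
      (by rw [mul_assoc, ← mul_assoc Ka', hKa2Ka, one_mul, hKb2Kb])
      (by rw [hKK, mul_assoc, ← mul_assoc Ka, hKaKa2, one_mul, hKbKb2])
  have hKKinv : Ka * Kb * (Ka' * Kb') = 1 := by
    rw [hKK, mul_assoc, ← mul_assoc Ka, hKaKa2, one_mul, hKbKb2]
  have hEaKK : Ea * Kb * (Ka' * Kb') = Ea * Ka' := by
    rw [← hKK', mul_assoc, ← mul_assoc Kb, hKbKb2, one_mul]
  have hKbKaKb : Kb * (Ka' * Kb') = Ka' := by
    rw [← hKK', ← mul_assoc, hKbKb2, one_mul]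
  have hKbEa' := mul_eq_smul_mul_of_conj hKb2Kb hKbEa
  have hKaEb' := mul_eq_smul_mul_of_conj hKa2Ka hKaEb
  have hKbFa' := inv_mul_eq_smul_mul_of_conj hq hKb2Kb hKbFa
  have hKaFb' := inv_mul_eq_smul_mul_of_conj hq hKa2Ka hKaFb
  have hΔY : Δ (Ea * Ka' + lamP • Ka')
      = (Ea * Ka' + lamP • Ka') ⊗ₜ[ℂ] Ka' + 1 ⊗ₜ[ℂ] (Ea * Ka') := by
    simp only [map_add, map_mul, map_smul, hΔEa, hΔKa2, add_mul,
      Algebra.TensorProduct.tmul_mul_tmul, hKaKa2, one_mul, add_tmul, smul_tmul']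
    abel
  have hΔZ : Δ (Fa + lamM • Ka') = (Fa + lamM • Ka') ⊗ₜ[ℂ] Ka' + 1 ⊗ₜ[ℂ] Fa := by
    simp only [map_add, map_smul, hΔFa, hΔKa2, add_tmul, smul_tmul']
    abel
  have hΔE : Δ (Ea * Eb - q⁻¹ • (Eb * Ea)) = (Ea * Eb - q⁻¹ • (Eb * Ea)) ⊗ₜ[ℂ] 1
      + (1 - (q ^ 2)⁻¹) • ((Ea * Kb) ⊗ₜ[ℂ] Eb)
      + (Ka * Kb) ⊗ₜ[ℂ] (Ea * Eb - q⁻¹ • (Eb * Ea)) := by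
    simp only [map_sub, map_mul, map_smul, hΔEa, hΔEb, add_mul, mul_add,
      Algebra.TensorProduct.tmul_mul_tmul, one_mul, mul_one, hKbEa', hKaEb', ← hKK,
      sub_tmul, tmul_sub, ← smul_tmul', tmul_smul]
    module
  have hΔF : Δ (Fa * Fb - q • (Fb * Fa)) = (Fa * Fb - q • (Fb * Fa)) ⊗ₜ[ℂ] (Ka' * Kb')
      + (q⁻¹ - q) • (Fa ⊗ₜ[ℂ] (Fb * Ka')) + 1 ⊗ₜ[ℂ] (Fa * Fb - q • (Fb * Fa)) := by
    simp only [map_sub, map_mul, map_smul, hΔFa, hΔFb, add_mul, mul_add,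
      Algebra.TensorProduct.tmul_mul_tmul, one_mul, mul_one, hKbFa', hKaFb', hKK',
      sub_tmul, tmul_sub, ← smul_tmul', tmul_smul, smul_add, smul_smul, mul_inv_cancel₀ hq,
      one_smul]
    module
  apply isRCS_adjoin
  set S : Set A := {(Ea * Eb - q⁻¹ • (Eb * Ea)) * (Ka' * Kb')
          + (lamP * (1 - (q ^ 2)⁻¹)) • (Eb * (Ka' * Kb'))
          + cF • (Fa * Fb - q • (Fb * Fa))
          + (cF * (q⁻¹ - q) * lamM) • (Fb * Ka'),
        Ea * Ka' + lamP • Ka',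
        Fa + lamM • Ka'} with hS
  have hY : Ea * Ka' + lamP • Ka' ∈ Algebra.adjoin ℂ S := Algebra.subset_adjoin (by simp [hS])
  have hZ : Fa + lamM • Ka' ∈ Algebra.adjoin ℂ S := Algebra.subset_adjoin (by simp [hS])
  have hone := one_mem (Algebra.adjoin ℂ S)
  rintro x (rfl | rfl | rfl)
  · have hX := Algebra.subset_adjoin (R := ℂ) (s := S) (Set.mem_insert _ _)
    have hΔX := add_mem (add_mem (add_mem (add_mem
      (tmul_mem_range_map_val hX (Ka' * Kb'))
      (tmul_mem_range_map_val hY ((1 - (q ^ 2)⁻¹) • (Eb * (Ka' * Kb')))))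
      (tmul_mem_range_map_val hZ ((cF * (q⁻¹ - q)) • (Fb * Ka'))))
      (tmul_mem_range_map_val hone ((Ea * Eb - q⁻¹ • (Eb * Ea)) * (Ka' * Kb'))))
      (tmul_mem_range_map_val hone (cF • (Fa * Fb - q • (Fb * Fa))))
    convert hΔX using 1
    rw [map_add, map_add, map_add, map_smul, map_smul, map_smul, map_mul, hΔE, hΔF]
    generalize Ea * Eb - q⁻¹ • (Eb * Ea) = Eab
    generalize Fa * Fb - q • (Fb * Fa) = Fba
    simp only [map_mul, hΔEb, hΔFb, hΔKa2, hΔKb2, add_mul, smul_mul_assoc,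
      Algebra.TensorProduct.tmul_mul_tmul, one_mul, hKKinv, hEaKK, hKK', hKbKaKb,
      add_tmul, ← smul_tmul', tmul_smul]
    module
  · rw [hΔY]
    exact add_mem (tmul_mem_range_map_val hY _) (tmul_mem_range_map_val hone _)
  · rw [hΔZ]
    exact add_mem (tmul_mem_range_map_val hZ _) (tmul_mem_range_map_val hone _)
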